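/- Let L be a binary relational language and let M and N be 3-equivalent L-structures. For an FO3(L)-formula ρ with free variables among x,y, let ρ(M) = {(a,b) ∈ M × M : M ⊨ ρ[a,b]} and similarly ρ(N). Then the relation {(ρ(M), ρ(N)) : ρ(x,y) ∈ FO3(L)} is a well-defined bijection from the set of FO3-definable binary relations of M onto the set of FO3-definable binary relations of N, and this bijection preserves union, complementation (relative to M × M and N × N respectively), converse, composition of binary relations, and maps the identity relation {(u,u) : u ∈ M} to the identity relation {(u,u) : u ∈ N}. -/

import Mathlib

namespace AN

/-- Formulas of first-order logic over a binary relational language `L`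
(a type whose elements are the binary relation symbols; there are no
function or constant symbols) with variables from `V`. -/
inductive FOV (L : Type) (V : Type) : Type
  | eq : V → V → FOV L V
  | rel : L → V → V → FOV L V
  | not : FOV L V → FOV L V
  | and : FOV L V → FOV L V → FOV L V
  | ex : V → FOV L V → FOV L V

/-- An `L`-structure on universe `M`: an interpretation of each binary
relation symbol as a binary relation on `M`. -/
abbrev Str (L M : Type) := L → M → M → Prop

/-- Satisfaction of a formula in a structure under a valuation of the variables. -/
def Sat {L V M : Type} [DecidableEq V] (S : Str L M) : FOV L V → (V → M) → Prop
  | .eq i j, v => v i = v j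
  | .rel r i j, v => S r (v i) (v j)
  | .not φ, v => ¬ Sat S φ v
  | .and φ ψ, v => Sat S φ v ∧ Sat S ψ v
  | .ex i φ, v => ∃ m : M, Sat S φ (Function.update v i m)

/-- The free variables of a formula. -/
def Free {L V : Type} : FOV L V → Set V
  | .eq i j => {i, j}
  | .rel _ i j => {i, j}
  | .not φ => Free φ
  | .and φ ψ => Free φ ∪ Free ψ
  | .ex i φ => Free φ \ {i}

/-- A sentence is a formula with no free variables. -/
def Sentence {L V : Type} (φ : FOV L V) : Prop := Free φ = ∅

/-- The two-variable fragment FO2(L): formulas built from the two variables x, y. -/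
abbrev FO2 (L : Type) := FOV L (Fin 2)

/-- The three-variable fragment FO3(L): formulas built from the three variables x, y, z. -/
abbrev FO3 (L : Type) := FOV L (Fin 3)

/-- `M ⊨ φ[a,b]` : the FO2-formula φ holds with x interpreted as a and y as b. -/
def Sat2 {L M : Type} (S : Str L M) (φ : FO2 L) (a b : M) : Prop :=
  Sat S φ ![a, b]

/-- The 2-type of the pair (a,b) in the structure: all FO2-formulas true of (a,b). -/
def Type2 {L M : Type} (S : Str L M) (a b : M) : Set (FO2 L) :=
  {φ | Sat2 S φ a b}

/-- `f` is an automorphism of the structure `S`. -/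
def IsAuto {L M : Type} (S : Str L M) (f : M ≃ M) : Prop :=
  ∀ r a b, S r a b ↔ S r (f a) (f b)

/-- A structure is transitive if any two elements of the same type are
connected by an automorphism. -/
def IsTransitive {L M : Type} (S : Str L M) : Prop :=
  ∀ a b : M, Type2 S a a = Type2 S b b →
    ∃ f : M ≃ M, IsAuto S f ∧ f a = b

/-- A structure is 2-homogeneous if whenever a and b have the same type,
every c can be matched by some d with Type(a,c) = Type(b,d). -/
def IsHomog2 {L M : Type} (S : Str L M) : Prop :=
  ∀ a b c : M, Type2 S a a = Type2 S b b →
    ∃ d : M, Type2 S a c = Type2 S b d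

/-- A 2-partial isomorphism between `S` and `T`, presented by its part `i1`
relating elements and its part `i2` relating pairs. -/
structure IsTwoIso {L M N : Type} (S : Str L M) (T : Str L N)
    (i1 : M → N → Prop) (i2 : M → M → N → N → Prop) : Prop where
  eq_iff : ∀ a b a' b', i2 a b a' b' → (a = b ↔ a' = b')
  rel_iff2 : ∀ a b a' b', i2 a b a' b' → ∀ r,
      (S r a a ↔ T r a' a') ∧ (S r a b ↔ T r a' b') ∧
      (S r b a ↔ T r b' a') ∧ (S r b b ↔ T r b' b')
  rel_iff1 : ∀ a a', i1 a a' → ∀ r, S r a a ↔ T r a' a'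
  restrict : ∀ a b a' b', i2 a b a' b' → i1 a a' ∧ i1 b b'
  forth1 : ∀ a, ∃ a', i1 a a'
  back1 : ∀ a', ∃ a, i1 a a'
  forth2 : ∀ a a', i1 a a' → ∀ b, ∃ b', i2 a b a' b'
  back2 : ∀ a a', i1 a a' → ∀ b', ∃ b, i2 a b a' b'

/-- Two structures are 2-isomorphic when some 2-partial isomorphism between
them exists. -/
def TwoIsomorphic {L M N : Type} (S : Str L M) (T : Str L N) : Prop :=
  ∃ i1 i2, IsTwoIso S T i1 i2

/-- 2-equivalence: the same FO2 sentences hold in both structures. -/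
def Equiv2 {L M N : Type} (S : Str L M) (T : Str L N) : Prop :=
  ∀ φ : FO2 L, Sentence φ → ((∀ v, Sat S φ v) ↔ (∀ v, Sat T φ v))

/-- 3-equivalence: the same FO3 sentences hold in both structures. -/
def Equiv3 {L M N : Type} (S : Str L M) (T : Str L N) : Prop :=
  ∀ φ : FO3 L, Sentence φ → ((∀ v, Sat S φ v) ↔ (∀ v, Sat T φ v))

/-- Expansion of an `L`-structure by one new binary relation `R`; the new
relation symbol is `Sum.inr ()`, so the expanded language is `L ⊕ Unit`. -/
def expand {L M : Type} (S : Str L M) (R : M → M → Prop) : Str (L ⊕ Unit) M :=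
  Sum.elim S (fun _ => R)

/-- `S` is a model of the set `Th` of sentences. -/
def ModelsSet {L V M : Type} [DecidableEq V] (S : Str L M) (Th : Set (FOV L V)) : Prop :=
  ∀ φ ∈ Th, ∀ v : V → M, Sat S φ v

/-- `Sg` is a weak implicit definition of the new relation symbol w.r.t. `Th`:
in each model of `Th` there is at most one relation satisfying `Sg`. -/
def WeakImplicitDef (L : Type) (Th : Set (FO2 L)) (Sg : Set (FO2 (L ⊕ Unit))) : Prop :=
  ∀ (M : Type) (S : Str L M), Nonempty M → ModelsSet S Th →
    ∀ R R' : M → M → Prop,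
      ModelsSet (expand S R) Sg → ModelsSet (expand S R') Sg → R = R'

/-- `Sg` is a strong implicit definition of the new relation symbol w.r.t. `Th`:
in each model of `Th` there is exactly one relation satisfying `Sg`. -/
def StrongImplicitDef (L : Type) (Th : Set (FO2 L)) (Sg : Set (FO2 (L ⊕ Unit))) : Prop :=
  ∀ (M : Type) (S : Str L M), Nonempty M → ModelsSet S Th →
    ∃! R : M → M → Prop, ModelsSet (expand S R) Sg

/-- `Sg` can be made explicit w.r.t. `Th`: there is an FO2(L)-formula φ(x,y)
with Th ∪ Sg ⊨ ∀x∀y (R(x,y) ↔ φ(x,y)). -/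
def MadeExplicit (L : Type) (Th : Set (FO2 L)) (Sg : Set (FO2 (L ⊕ Unit))) : Prop :=
  ∃ φ : FO2 L, ∀ (M : Type) (S : Str L M), Nonempty M → ModelsSet S Th →
    ∀ R : M → M → Prop, ModelsSet (expand S R) Sg →
      ∀ a b : M, R a b ↔ Sat2 S φ a b

/-- `R` does not cut 2-types in `S`. -/
def NoCut {L M : Type} (S : Str L M) (R : M → M → Prop) : Prop :=
  ∀ a b c d : M, Type2 S a b = Type2 S c d → (R a b ↔ R c d)

/-- The valuation sending the variable `0` (i.e. x) to `m` and the variables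
`1,…,k` (the constants naming the tuple `t`) to the entries of `t`. -/
def valCons {M : Type} (m : M) {k : ℕ} (t : Fin k → M) : ℕ → M :=
  fun i => if h : 0 < i ∧ i - 1 < k then t ⟨i - 1, h.2⟩ else m

/-- ω-saturation, phrased with formulas whose free variables are among
x = variable 0 and the constants = variables 1,…,k naming a finite tuple t:
if every finite subset of Γ(x) is satisfiable in (M,t), then Γ(x) is realized. -/
def OmegaSaturated {L M : Type} (S : Str L M) : Prop :=
  ∀ (k : ℕ) (t : Fin k → M) (Γ : Set (FOV L ℕ)),
    (∀ φ ∈ Γ, Free φ ⊆ {i | i ≤ k}) →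
    (∀ Γ₀ : Finset (FOV L ℕ), ↑Γ₀ ⊆ Γ →
        ∃ m : M, ∀ φ ∈ Γ₀, Sat S φ (valCons m t)) →
    ∃ m : M, ∀ φ ∈ Γ, Sat S φ (valCons m t)

/-- The new relation symbol cannot cut the formula π:
Th ∪ Sg ⊨ ∀x∀y(π → R(x,y)) or Th ∪ Sg ⊨ ∀x∀y(π → ¬R(x,y)). -/
def CannotCut (L : Type) (Th : Set (FO2 L)) (Sg : Set (FO2 (L ⊕ Unit))) (π : FO2 L) : Prop :=
  (∀ (M : Type) (S : Str L M), Nonempty M → ModelsSet S Th →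
      ∀ R : M → M → Prop, ModelsSet (expand S R) Sg →
        ∀ a b : M, Sat2 S π a b → R a b) ∨
  (∀ (M : Type) (S : Str L M), Nonempty M → ModelsSet S Th →
      ∀ R : M → M → Prop, ModelsSet (expand S R) Sg →
        ∀ a b : M, Sat2 S π a b → ¬ R a b)

/-- `π` is a 2-partition with respect to Th ∪ Sg: Th ∪ Sg ⊨ ∀x∀y ⋁ᵢ πᵢ and
Th ∪ Sg ⊨ ∀x∀y ¬(πᵢ ∧ πⱼ) for i < j. -/
def IsTwoPartition (L : Type) (Th : Set (FO2 L)) (Sg : Set (FO2 (L ⊕ Unit)))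
    {n : ℕ} (π : Fin (n + 1) → FO2 L) : Prop :=
  ∀ (M : Type) (S : Str L M), Nonempty M → ModelsSet S Th →
    ∀ R : M → M → Prop, ModelsSet (expand S R) Sg →
      (∀ a b : M, ∃ i, Sat2 S (π i) a b) ∧
      (∀ a b : M, ∀ i j : Fin (n + 1), i < j →
        ¬(Sat2 S (π i) a b ∧ Sat2 S (π j) a b))

/-- The binary relation defined in `S` by an FO3-formula ρ(x,y) with free
variables among x = 0 and y = 1 (the value of z is immaterial). -/
def rel3 {L M : Type} (S : Str L M) (ρ : FO3 L) : Set (M × M) :=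
  {p | Sat S ρ ![p.1, p.2, p.2]}

/-- The FO3-definable binary relations of `S`. -/
def Def3 {L M : Type} (S : Str L M) : Set (Set (M × M)) :=
  {Z | ∃ ρ : FO3 L, Free ρ ⊆ ({0, 1} : Set (Fin 3)) ∧ Z = rel3 S ρ}

/-- Converse of a binary relation. -/
def conv {M : Type} (Z : Set (M × M)) : Set (M × M) := {p | (p.2, p.1) ∈ Z}

/-- Composition of binary relations. -/
def comp {M : Type} (Z W : Set (M × M)) : Set (M × M) :=
  {p | ∃ v, (p.1, v) ∈ Z ∧ (v, p.2) ∈ W}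

/-- Renaming of all variables, free and bound, along a map of variables. -/
def FOV.rename {L V W : Type} (σ : V → W) : FOV L V → FOV L W
  | .eq i j => .eq (σ i) (σ j)
  | .rel r i j => .rel r (σ i) (σ j)
  | .not φ => .not (φ.rename σ)
  | .and φ ψ => .and (φ.rename σ) (ψ.rename σ)
  | .ex i φ => .ex (σ i) (φ.rename σ)

theorem sat_rename {L V W M : Type} [DecidableEq V] [DecidableEq W] (S : Str L M)
    {σ : V → W} (hσ : Function.Injective σ) (φ : FOV L V) (v : W → M) :
    Sat S (φ.rename σ) v ↔ Sat S φ (v ∘ σ) := by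
  induction φ generalizing v with
  | eq i j => rfl
  | rel r i j => rfl
  | not φ ih => exact not_congr (ih v)
  | and φ ψ ihφ ihψ => exact and_congr (ihφ v) (ihψ v)
  | ex i φ ih =>
    refine exists_congr fun m => ?_
    rw [ih, Function.update_comp_eq_of_injective v hσ]

theorem free_rename {L V W : Type} {σ : V → W} (hσ : Function.Injective σ) (φ : FOV L V) :
    Free (φ.rename σ) = σ '' Free φ := by
  induction φ with
  | eq i j => exact (Set.image_pair σ i j).symm
  | rel r i j => exact (Set.image_pair σ i j).symm
  | not φ ih => exact ih
  | and φ ψ ihφ ihψ => simp only [FOV.rename, Free, ihφ, ihψ, Set.image_union]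
  | ex i φ ih => simp only [FOV.rename, Free, ih, Set.image_sdiff hσ, Set.image_singleton]

/-- Satisfaction depends only on the values of the free variables. -/
theorem sat_congr {L V M : Type} [DecidableEq V] (S : Str L M) (φ : FOV L V) {v w : V → M}
    (hvw : Set.EqOn v w (Free φ)) : Sat S φ v ↔ Sat S φ w := by
  induction φ generalizing v w with
  | eq i j => simp only [Sat, hvw (show i ∈ Free (.eq i j : FOV L V) from Or.inl rfl),
      hvw (show j ∈ Free (.eq i j : FOV L V) from Or.inr rfl)]
  | rel r i j => simp only [Sat, hvw (show i ∈ Free (.rel r i j) from Or.inl rfl),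
      hvw (show j ∈ Free (.rel r i j) from Or.inr rfl)]
  | not φ ih => exact not_congr (ih hvw)
  | and φ ψ ihφ ihψ =>
    exact and_congr (ihφ fun k hk => hvw (Or.inl hk)) (ihψ fun k hk => hvw (Or.inr hk))
  | ex i φ ih =>
    refine exists_congr fun m => ih fun k hk => ?_
    by_cases hki : k = i
    · subst hki
      simp
    · simpa [hki] using hvw (show k ∈ Free (.ex i φ) from ⟨hk, hki⟩)

/-- The free variables of `φ` are among x and y. -/
abbrev FreeXY {L : Type} (φ : FO3 L) : Prop := Free φ ⊆ ({0, 1} : Set (Fin 3))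

theorem FreeXY.mem_rel3 {L M : Type} (S : Str L M) {φ : FO3 L} (hφ : FreeXY φ)
    (v : Fin 3 → M) : (v 0, v 1) ∈ rel3 S φ ↔ Sat S φ v := by
  refine sat_congr S φ fun k hk => ?_
  rcases hφ hk with rfl | rfl <;> rfl

theorem rel3_not {L M : Type} (S : Str L M) (φ : FO3 L) : rel3 S (.not φ) = (rel3 S φ)ᶜ := rfl

theorem rel3_and {L M : Type} (S : Str L M) (φ ψ : FO3 L) :
    rel3 S (.and φ ψ) = rel3 S φ ∩ rel3 S ψ := rfl

theorem FreeXY.and {L : Type} {φ ψ : FO3 L} (hφ : FreeXY φ) (hψ : FreeXY ψ) :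
    FreeXY (.and φ ψ) := Set.union_subset hφ hψ

/-- The disjunction of two formulas. -/
def FOV.or {L V : Type} (φ ψ : FOV L V) : FOV L V := .not (.and (.not φ) (.not ψ))

theorem rel3_or {L M : Type} (S : Str L M) (φ ψ : FO3 L) :
    rel3 S (φ.or ψ) = rel3 S φ ∪ rel3 S ψ := by
  simp only [FOV.or, rel3_not, rel3_and, Set.compl_inter, compl_compl]

theorem FreeXY.or {L : Type} {φ ψ : FO3 L} (hφ : FreeXY φ) (hψ : FreeXY ψ) :
    FreeXY (φ.or ψ) := Set.union_subset hφ hψ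

/-- The formula φ(y,x). -/
def FOV.conv {L : Type} (φ : FO3 L) : FO3 L := φ.rename (Equiv.swap 0 1)

theorem FreeXY.conv {L : Type} {φ : FO3 L} (hφ : FreeXY φ) : FreeXY φ.conv := by
  rw [FreeXY, FOV.conv, free_rename (Equiv.injective _)]
  rintro _ ⟨k, hk, rfl⟩
  rcases hφ hk with rfl | rfl <;> decide

theorem FreeXY.rel3_conv {L M : Type} (S : Str L M) {φ : FO3 L} (hφ : FreeXY φ) :
    rel3 S φ.conv = AN.conv (rel3 S φ) := by
  ext ⟨a, b⟩
  exact (sat_rename S (Equiv.injective _) φ _).trans (hφ.mem_rel3 S _).symm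

/-- The formula ∃z (φ(x,z) ∧ ψ(z,y)). -/
def FOV.comp {L : Type} (φ ψ : FO3 L) : FO3 L :=
  .ex 2 (.and (φ.rename (Equiv.swap 1 2)) (ψ.rename (Equiv.swap 0 2)))

theorem FreeXY.comp {L : Type} {φ ψ : FO3 L} : FreeXY (φ.comp ψ) := by
  rintro k ⟨-, hk⟩
  fin_cases k
  · exact Or.inl rfl
  · exact Or.inr rfl
  · exact absurd rfl hk

theorem FreeXY.rel3_comp {L M : Type} (S : Str L M) {φ ψ : FO3 L} (hφ : FreeXY φ)
    (hψ : FreeXY ψ) : rel3 S (φ.comp ψ) = AN.comp (rel3 S φ) (rel3 S ψ) := by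
  ext ⟨a, b⟩
  refine exists_congr fun m => and_congr ?_ ?_
  · exact (sat_rename S (Equiv.injective _) φ _).trans (hφ.mem_rel3 S _).symm
  · exact (sat_rename S (Equiv.injective _) ψ _).trans (hψ.mem_rel3 S _).symm

/-- The sentence ∀x∀y ¬φ. -/
def FOV.never {L : Type} (φ : FO3 L) : FO3 L := .not (.ex 0 (.ex 1 φ))

theorem FreeXY.sentence_never {L : Type} {φ : FO3 L} (hφ : FreeXY φ) : Sentence φ.never := by
  refine Set.eq_empty_of_forall_notMem ?_
  rintro k ⟨⟨hk, hk1⟩, hk0⟩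
  exact (hφ hk).elim hk0 hk1

theorem FreeXY.forall_sat_never {L M : Type} [Nonempty M] (S : Str L M) {φ : FO3 L}
    (hφ : FreeXY φ) : (∀ v, Sat S φ.never v) ↔ rel3 S φ = ∅ := by
  have key (v : Fin 3 → M) : Sat S φ.never v ↔ ∀ a b, (a, b) ∉ rel3 S φ := by
    simp only [FOV.never, Sat, not_exists]
    exact forall_congr' fun a => forall_congr' fun b => not_congr (hφ.mem_rel3 S _).symm
  simp only [key, forall_const, Set.eq_empty_iff_forall_notMem, Prod.forall]

section Equiv3

variable {L M N : Type} [Nonempty M] [Nonempty N] {S : Str L M} {T : Str L N}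

theorem Equiv3.rel3_subset_iff (h : Equiv3 S T) {ρ τ : FO3 L} (hρ : FreeXY ρ) (hτ : FreeXY τ) :
    rel3 S ρ ⊆ rel3 S τ ↔ rel3 T ρ ⊆ rel3 T τ := by
  have hd : FreeXY (.and ρ (.not τ)) := hρ.and hτ
  have := h _ hd.sentence_never
  rw [hd.forall_sat_never S, hd.forall_sat_never T] at this
  simpa only [rel3_and, rel3_not, ← Set.sdiff_eq, Set.sdiff_eq_empty] using this

theorem Equiv3.rel3_eq_iff (h : Equiv3 S T) {ρ τ : FO3 L} (hρ : FreeXY ρ) (hτ : FreeXY τ) :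
    rel3 S ρ = rel3 S τ ↔ rel3 T ρ = rel3 T τ := by
  simp only [Set.Subset.antisymm_iff, h.rel3_subset_iff hρ hτ, h.rel3_subset_iff hτ hρ]

end Equiv3

/-- If M and N are 3-equivalent, then ρ(M) ↦ ρ(N) is a
well-defined bijection between the FO3-definable binary relations of M and
those of N, preserving union, complement, converse, composition and the
identity relation. -/
theorem stmt15 (L M N : Type) [Nonempty M] [Nonempty N]
    (S : Str L M) (T : Str L N) (h : Equiv3 S T) :
    ∃ F : Set (M × M) → Set (N × N),
      (∀ ρ : FO3 L, Free ρ ⊆ ({0, 1} : Set (Fin 3)) → F (rel3 S ρ) = rel3 T ρ) ∧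
      Set.BijOn F (Def3 S) (Def3 T) ∧
      (∀ Z ∈ Def3 S, ∀ W ∈ Def3 S, F (Z ∪ W) = F Z ∪ F W) ∧
      (∀ Z ∈ Def3 S, F Zᶜ = (F Z)ᶜ) ∧
      (∀ Z ∈ Def3 S, F (conv Z) = conv (F Z)) ∧
      (∀ Z ∈ Def3 S, ∀ W ∈ Def3 S, F (comp Z W) = comp (F Z) (F W)) ∧
      F {p : M × M | p.1 = p.2} = {p : N × N | p.1 = p.2} := by
  classical
  obtain ⟨F, hF⟩ : ∃ F : Set (M × M) → Set (N × N),
      ∀ ρ : FO3 L, FreeXY ρ → F (rel3 S ρ) = rel3 T ρ := by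
    refine ⟨fun Z => if hZ : Z ∈ Def3 S then rel3 T hZ.choose else ∅, fun ρ hρ => ?_⟩
    have hZ : rel3 S ρ ∈ Def3 S := ⟨ρ, hρ, rfl⟩
    simp only [dif_pos hZ]
    exact (h.rel3_eq_iff hZ.choose_spec.1 hρ).1 hZ.choose_spec.2.symm
  refine ⟨F, hF, ⟨?_, ?_, ?_⟩, ?_, ?_, ?_, ?_, ?_⟩
  · rintro _ ⟨ρ, hρ, rfl⟩
    exact ⟨ρ, hρ, hF ρ hρ⟩
  · rintro _ ⟨ρ, hρ, rfl⟩ _ ⟨τ, hτ, rfl⟩ e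
    rw [hF ρ hρ, hF τ hτ] at e
    exact (h.rel3_eq_iff hρ hτ).2 e
  · rintro _ ⟨ρ, hρ, rfl⟩
    exact ⟨rel3 S ρ, ⟨ρ, hρ, rfl⟩, hF ρ hρ⟩
  · rintro _ ⟨ρ, hρ, rfl⟩ _ ⟨τ, hτ, rfl⟩
    rw [← rel3_or, hF _ (FreeXY.or hρ hτ), hF ρ hρ, hF τ hτ, rel3_or]
  · rintro _ ⟨ρ, hρ, rfl⟩
    rw [← rel3_not, hF (.not ρ) hρ, hF ρ hρ, rel3_not]
  · rintro _ ⟨ρ, hρ, rfl⟩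
    rw [← FreeXY.rel3_conv S hρ, hF _ (FreeXY.conv hρ), hF ρ hρ, FreeXY.rel3_conv T hρ]
  · rintro _ ⟨ρ, hρ, rfl⟩ _ ⟨τ, hτ, rfl⟩
    rw [← FreeXY.rel3_comp S hρ hτ, hF _ FreeXY.comp, hF ρ hρ, hF τ hτ,
      FreeXY.rel3_comp T hρ hτ]
  · exact hF (.eq 0 1) subset_rfl

end AN
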